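/- Let G be a finite simple connected graph that has no G-good spanning tree, and suppose that every finite simple connected graph with fewer vertices than G has a good spanning tree (with respect to itself). Then G has minimum degree at least 3. -/

import Mathlib

open SimpleGraph

/-- The degree of a vertex `v` in a simple graph `H`. -/
noncomputable def gdeg {V : Type} (H : SimpleGraph V) (v : V) : ℕ :=
  Nat.card (H.neighborSet v)

/-- A subgraph `T` of `G` (on the same vertex set) is `G`-good if it contains no path of
length 2 all of whose three vertices have degree at least 3 in `G` and degree 2 in `T`. -/
def GoodSubgraph {W : Type} (G T : SimpleGraph W) : Prop :=
  ¬∃ a b c : W, a ≠ c ∧ T.Adj a b ∧ T.Adj b c ∧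
    gdeg T a = 2 ∧ gdeg T b = 2 ∧ gdeg T c = 2 ∧
    3 ≤ gdeg G a ∧ 3 ≤ gdeg G b ∧ 3 ≤ gdeg G c


theorem reach_map {V W : Type} {G : SimpleGraph V} {H : SimpleGraph W} (f : V → W)
    (h : ∀ a b, G.Adj a b → H.Reachable (f a) (f b)) {a b : V} (hab : G.Reachable a b) :
    H.Reachable (f a) (f b) := by
  obtain ⟨p⟩ := hab
  induction p with
  | nil => exact Reachable.refl _
  | cons e p ih => exact (h _ _ e).trans ih

theorem not_reach_of_closed {V : Type} {H : SimpleGraph V} (S : Set V)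
    (h : ∀ a b, H.Adj a b → a ∈ S → b ∈ S) {a b : V} (ha : a ∈ S) (hb : b ∉ S) :
    ¬ H.Reachable a b := by
  rintro ⟨p⟩
  induction p with
  | nil => exact hb ha
  | cons e p ih => exact ih (h _ _ e ha) hb

/-- remove the edge `bc`, add the edge `ux`. -/
def swapE {V : Type} (T : SimpleGraph V) (b c u x : V) : SimpleGraph V :=
  T.deleteEdges {s(b, c)} ⊔ edge u x

theorem del_adj {V : Type} {T : SimpleGraph V} {b c p q : V} :
    (T.deleteEdges {s(b, c)}).Adj p q ↔ T.Adj p q ∧ ¬ (p = b ∧ q = c ∨ p = c ∧ q = b) := by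
  simp [deleteEdges_adj]

theorem add_adj {V : Type} {T : SimpleGraph V} {u x p q : V} :
    (T ⊔ edge u x).Adj p q ↔ T.Adj p q ∨ ((p = u ∧ q = x ∨ p = x ∧ q = u) ∧ p ≠ q) := by
  simp [edge_adj]

theorem swapE_adj {V : Type} {T : SimpleGraph V} {b c u x p q : V} :
    (swapE T b c u x).Adj p q ↔ (T.Adj p q ∧ ¬ (p = b ∧ q = c ∨ p = c ∧ q = b)) ∨
      ((p = u ∧ q = x ∨ p = x ∧ q = u) ∧ p ≠ q) := by
  rw [swapE, add_adj, del_adj]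

theorem bridge_of_tree {V : Type} {T : SimpleGraph V} (hT : T.IsAcyclic) {b c : V}
    (h : T.Adj b c) : ¬ (T.deleteEdges {s(b, c)}).Reachable b c := by
  have := isAcyclic_iff_forall_adj_isBridge.1 hT h
  exact isBridge_iff.1 this

theorem swapE_tree {V : Type} {T : SimpleGraph V} (hT : T.IsTree) {b c u x : V}
    (h : ¬ (T.deleteEdges {s(b, c)}).Reachable u x) : (swapE T b c u x).IsTree := by
  have hside : ∀ y, (T.deleteEdges {s(b, c)}).Reachable y b ∨
      (T.deleteEdges {s(b, c)}).Reachable y c := by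
    intro y
    obtain ⟨p⟩ := hT.1.preconnected y b
    induction p with
    | nil => exact Or.inl (Reachable.refl _)
    | @cons y1 y2 y3 e p ih =>
      by_cases hc : y1 = y3 ∧ y2 = c ∨ y1 = c ∧ y2 = y3
      · rcases hc with ⟨rfl, rfl⟩ | ⟨rfl, rfl⟩
        · exact Or.inl (Reachable.refl _)
        · exact Or.inr (Reachable.refl _)
      · have e' : (T.deleteEdges {s(y3, c)}).Adj y1 y2 := del_adj.2 ⟨e, hc⟩
        rcases ih h with ih | ih
        · exact Or.inl (e'.reachable.trans ih)
        · exact Or.inr (e'.reachable.trans ih)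
  have hle : T.deleteEdges {s(b, c)} ≤ swapE T b c u x := le_sup_left
  have hux : u ≠ x := by rintro rfl; exact h (Reachable.refl _)
  have hE : (swapE T b c u x).Reachable u x := by
    apply Adj.reachable; rw [swapE_adj]; exact Or.inr ⟨Or.inl ⟨rfl, rfl⟩, hux⟩
  have hbc : (swapE T b c u x).Reachable b c := by
    rcases hside u with hu | hu <;> rcases hside x with hx | hx
    · exact absurd (hu.trans hx.symm) h
    · exact ((hu.mono hle).symm.trans hE).trans (hx.mono hle)
    · exact ((hx.mono hle).symm.trans hE.symm).trans (hu.mono hle)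
    · exact absurd (hu.trans hx.symm) h
  have : Nonempty V := ⟨u⟩
  refine ⟨⟨fun p q => ?_⟩, ?_⟩
  · have key : ∀ y, (swapE T b c u x).Reachable y b := by
      intro y
      rcases hside y with hy | hy
      · exact hy.mono hle
      · exact (hy.mono hle).trans hbc.symm
    exact (key p).trans (key q).symm
  · exact IsAcyclic.sup_edge_of_not_reachable h (hT.2.anti (deleteEdges_le _))

/-- `T` is a tree on the vertex set `S`, and the other vertices are isolated. -/
def TreeOn {V : Type} (S : Set V) (T : SimpleGraph V) : Prop :=
  T.IsAcyclic ∧ (∀ a b, T.Adj a b → a ∈ S ∧ b ∈ S) ∧ ∀ a ∈ S, ∀ b ∈ S, T.Reachable a b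

theorem TreeOn.addLeaf {V : Type} {S : Set V} {T : SimpleGraph V} (h : TreeOn S T) {u v : V}
    (hu : u ∈ S) (hv : v ∉ S) : TreeOn (insert v S) (T ⊔ edge u v) := by
  have huv : u ≠ v := by rintro rfl; exact hv hu
  refine ⟨?_, ?_, ?_⟩
  · refine IsAcyclic.sup_edge_of_not_reachable ?_ h.1
    exact not_reach_of_closed S (fun a b hab _ => (h.2.1 a b hab).2) hu hv
  · intro a b hab
    rw [add_adj] at hab
    rcases hab with hab | ⟨⟨rfl, rfl⟩ | ⟨rfl, rfl⟩, _⟩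
    · exact ⟨Or.inr (h.2.1 a b hab).1, Or.inr (h.2.1 a b hab).2⟩
    · exact ⟨Or.inr hu, Or.inl rfl⟩
    · exact ⟨Or.inl rfl, Or.inr hu⟩
  · have hE : (T ⊔ edge u v).Reachable v u := by
      apply Adj.reachable; rw [add_adj]; exact Or.inr ⟨Or.inr ⟨rfl, rfl⟩, huv.symm⟩
    have key : ∀ a ∈ insert v S, (T ⊔ edge u v).Reachable a u := by
      rintro a (rfl | ha)
      · exact hE
      · exact (h.2.2 a ha u hu).mono le_sup_left
    intro a ha b hb
    exact (key a ha).trans (key b hb).symm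

theorem TreeOn.isTree {V : Type} {S : Set V} {T : SimpleGraph V} (h : TreeOn S T) [Nonempty V]
    (hS : ∀ a, a ∈ S) : T.IsTree :=
  ⟨⟨fun a b => h.2.2 a (hS a) b (hS b)⟩, h.1⟩

theorem gdeg_eq {V : Type} (H : SimpleGraph V) (v : V) : gdeg H v = (H.neighborSet v).ncard := rfl

theorem gdeg_congr {V : Type} {H K : SimpleGraph V} {v : V} (h : ∀ x, H.Adj v x ↔ K.Adj v x) :
    gdeg H v = gdeg K v := by
  rw [gdeg_eq, gdeg_eq]; congr 1; ext x; exact h x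

theorem gdeg_le {V : Type} [Fintype V] {H K : SimpleGraph V} {v : V}
    (h : ∀ x, H.Adj v x → K.Adj v x) : gdeg H v ≤ gdeg K v :=
  Set.ncard_le_ncard h (Set.toFinite _)

theorem gdeg_two {V : Type} {H : SimpleGraph V} {v : V} (h : gdeg H v = 2) :
    ∃ a b, a ≠ b ∧ ∀ x, H.Adj v x ↔ x = a ∨ x = b := by
  rw [gdeg_eq, Set.ncard_eq_two] at h
  obtain ⟨a, b, hab, h⟩ := h
  exact ⟨a, b, hab, fun x => by simpa using Set.ext_iff.1 h x⟩

theorem gdeg_two' {V : Type} {H : SimpleGraph V} {v a b : V} (h : gdeg H v = 2) (hab : a ≠ b)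
    (ha : H.Adj v a) (hb : H.Adj v b) : ∀ x, H.Adj v x ↔ x = a ∨ x = b := by
  obtain ⟨p, q, hpq, h⟩ := gdeg_two h
  have h1 := (h a).1 ha
  have h2 := (h b).1 hb
  intro x
  rw [h]
  grind

theorem gdeg_one {V : Type} {H : SimpleGraph V} {v : V} (h : gdeg H v = 1) :
    ∃ a, ∀ x, H.Adj v x ↔ x = a := by
  rw [gdeg_eq, Set.ncard_eq_one] at h
  obtain ⟨a, h⟩ := h
  exact ⟨a, fun x => by simpa using Set.ext_iff.1 h x⟩

theorem gdeg_eq_one {V : Type} {H : SimpleGraph V} {v a : V} (h : ∀ x, H.Adj v x ↔ x = a) :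
    gdeg H v = 1 := by
  rw [gdeg_eq, Set.ncard_eq_one]
  exact ⟨a, Set.ext fun x => by simpa using h x⟩

theorem gdeg_eq_three {V : Type} {H : SimpleGraph V} {v a b c : V} (hab : a ≠ b) (hac : a ≠ c)
    (hbc : b ≠ c) (h : ∀ x, H.Adj v x ↔ x = a ∨ x = b ∨ x = c) : gdeg H v = 3 := by
  rw [gdeg_eq, Set.ncard_eq_three]
  exact ⟨a, b, c, hab, hac, hbc, Set.ext fun x => by simpa using h x⟩

theorem gdeg_add {V : Type} [Fintype V] {H K : SimpleGraph V} {v z : V} (hz : ¬ H.Adj v z)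
    (h : ∀ x, K.Adj v x ↔ H.Adj v x ∨ x = z) : gdeg K v = gdeg H v + 1 := by
  rw [gdeg_eq, gdeg_eq, ← Set.ncard_insert_of_notMem (a := z) (by simpa using hz) (Set.toFinite _)]
  congr 1; ext x; simp [h, or_comm]

theorem exists_third {V : Type} [Fintype V] {H : SimpleGraph V} {v : V} (h : 3 ≤ gdeg H v)
    (a b : V) : ∃ x, H.Adj v x ∧ x ≠ a ∧ x ≠ b := by
  by_contra hc
  push Not at hc
  have : gdeg H v ≤ ({a, b} : Set V).ncard := by
    refine Set.ncard_le_ncard ?_ (Set.toFinite _)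
    intro x hx
    have := hc x hx
    simp only [Set.mem_insert_iff, Set.mem_singleton_iff]
    tauto
  have h2 := Set.ncard_insert_le a {b}
  rw [Set.ncard_singleton] at h2
  omega

def Bad {W : Type} (G T : SimpleGraph W) (a b c : W) : Prop :=
  a ≠ c ∧ T.Adj a b ∧ T.Adj b c ∧
    gdeg T a = 2 ∧ gdeg T b = 2 ∧ gdeg T c = 2 ∧
    3 ≤ gdeg G a ∧ 3 ≤ gdeg G b ∧ 3 ≤ gdeg G c

theorem good_iff {W : Type} {G T : SimpleGraph W} :
    GoodSubgraph G T ↔ ∀ a b c, ¬ Bad G T a b c := by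
  unfold GoodSubgraph Bad; push Not; rfl

theorem Bad.symm {W : Type} {G T : SimpleGraph W} {a b c : W} (h : Bad G T a b c) :
    Bad G T c b a := by
  obtain ⟨h1, h2, h3, h4, h5, h6, h7, h8, h9⟩ := h
  exact ⟨h1.symm, h3.symm, h2.symm, h6, h5, h4, h9, h8, h7⟩

/-- transfer of the minimality hypothesis to subsets of the vertex set -/
theorem transfer {V : Type} [Fintype V]
    (hmin : ∀ (W : Type) [Fintype W] (G' : SimpleGraph W),
      Fintype.card W < Fintype.card V → G'.Connected →
      ∃ T : SimpleGraph W, T ≤ G' ∧ T.IsTree ∧ GoodSubgraph G' T)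
    (S : Set V) (H : SimpleGraph V) (v s : V) (hv : v ∉ S) (hs : s ∈ S)
    (hH : ∀ a b, H.Adj a b → a ∈ S ∧ b ∈ S)
    (hconn : ∀ a ∈ S, ∀ b ∈ S, H.Reachable a b) :
    ∃ T : SimpleGraph V, T ≤ H ∧ TreeOn S T ∧ GoodSubgraph H T := by
  classical
  let r : V → S := fun x => if h : x ∈ S then ⟨x, h⟩ else ⟨s, hs⟩
  have hr : ∀ x : S, r x = x := fun x => by simp [r]
  have hr' : ∀ x ∈ S, (r x : V) = x := fun x hx => by simp [r, hx]
  obtain ⟨T0, hle, htree, hgood⟩ := hmin S (H.induce S) (by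
      apply Fintype.card_lt_of_injective_of_notMem (fun x : S => (x : V)) Subtype.val_injective (b := v)
      simpa using hv) (by
      have : Nonempty S := ⟨⟨s, hs⟩⟩
      refine ⟨fun a b => ?_⟩
      have := reach_map (H := H.induce S) r (fun a b hab => by
        apply Adj.reachable
        have := hH a b hab
        simp [hr', this, hab]) (hconn a a.2 b b.2)
      rwa [hr, hr] at this)
  let T : SimpleGraph V := T0.map (Function.Embedding.subtype (· ∈ S))
  have hTadj : ∀ a b : S, T.Adj a b ↔ T0.Adj a b := fun a b => by
    exact SimpleGraph.map_adj_apply (f := Function.Embedding.subtype (· ∈ S))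
  have hTS : ∀ a b, T.Adj a b → a ∈ S ∧ b ∈ S := by
    intro a b hab
    obtain ⟨-, a', b', -, rfl, rfl⟩ := hab
    exact ⟨a'.2, b'.2⟩
  have dT : ∀ a : S, gdeg T a = gdeg T0 a := by
    intro a
    rw [gdeg_eq, gdeg_eq, ← Set.ncard_image_of_injective _ Subtype.val_injective]
    congr 1; ext x
    constructor
    · intro hx
      exact ⟨⟨x, (hTS _ _ hx).2⟩, (hTadj a ⟨x, (hTS _ _ hx).2⟩).1 hx, rfl⟩
    · rintro ⟨y, hy, rfl⟩
      exact (hTadj a y).2 hy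
  have dH : ∀ a : S, gdeg H a = gdeg (H.induce S) a := by
    intro a
    rw [gdeg_eq, gdeg_eq, ← Set.ncard_image_of_injective _ Subtype.val_injective]
    congr 1; ext x
    constructor
    · intro hx
      exact ⟨⟨x, (hH _ _ hx).2⟩, hx, rfl⟩
    · rintro ⟨y, hy, rfl⟩
      exact hy
  refine ⟨T, ?_, ⟨?_, hTS, ?_⟩, ?_⟩
  · intro a b hab
    have h := hTS a b hab
    have := hle ((hTadj ⟨a, h.1⟩ ⟨b, h.2⟩).1 hab)
    exact this
  · rw [isAcyclic_iff_forall_adj_isBridge]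
    intro a b hab
    rw [isBridge_iff]
    intro hR
    have h := hTS a b hab
    have h0 := (hTadj ⟨a, h.1⟩ ⟨b, h.2⟩).1 hab
    refine bridge_of_tree htree.2 h0 ?_
    have := reach_map (H := T0.deleteEdges {s(⟨a, h.1⟩, ⟨b, h.2⟩)}) r (fun p q hpq => by
      apply Adj.reachable
      rw [del_adj] at hpq ⊢
      have h' := hTS p q hpq.1
      have e1 : r p = ⟨p, h'.1⟩ := hr ⟨p, h'.1⟩
      have e2 : r q = ⟨q, h'.2⟩ := hr ⟨q, h'.2⟩
      rw [e1, e2, ← hTadj]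
      simpa using hpq) hR
    rwa [hr ⟨a, h.1⟩, hr ⟨b, h.2⟩] at this
  · intro a ha b hb
    exact reach_map (G := T0) (fun x : S => (x : V)) (fun p q hpq => ((hTadj p q).2 hpq).reachable)
      (htree.1.preconnected ⟨a, ha⟩ ⟨b, hb⟩)
  · rw [good_iff] at hgood ⊢
    rintro a b c ⟨h1, h2, h3, h4, h5, h6, h7, h8, h9⟩
    have hab := hTS _ _ h2
    have hbc := hTS _ _ h3
    refine hgood ⟨a, hab.1⟩ ⟨b, hab.2⟩ ⟨c, hbc.2⟩ ⟨?_, ?_, ?_, ?_, ?_, ?_, ?_, ?_, ?_⟩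
    · simpa using h1
    · rw [← hTadj]; exact h2
    · rw [← hTadj]; exact h3
    all_goals first | rw [← dT] | rw [← dH]
    all_goals assumption

/-- A spanning tree all of whose bad paths contain `z`, where `z` carries a suitable pendant
piece `P`, can be turned into a good one. -/
theorem pendant {V : Type} [Fintype V] {G T : SimpleGraph V} (hTG : T ≤ G) (hT : T.IsTree)
    (z w : V) (P : Set V) (hzw : T.Adj z w) (hwP : w ∈ P) (hzP : z ∉ P)
    (hGP : ∀ x, G.Adj z x → x ∈ P → x = w)
    (hTP : ∀ a b, T.Adj a b → a ∈ P → b ∈ P ∨ (a = w ∧ b = z))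
    (hw : gdeg T w ≠ 2)
    (hbad : ∀ a b c, Bad G T a b c → z = a ∨ z = b ∨ z = c) :
    ∃ T : SimpleGraph V, T ≤ G ∧ T.IsTree ∧ GoodSubgraph G T := by
  by_cases hgood : GoodSubgraph G T
  · exact ⟨T, hTG, hT, hgood⟩
  have hex : ∃ b c, Bad G T z b c := by
    rw [good_iff] at hgood
    push Not at hgood
    obtain ⟨a, b, c, h⟩ := hgood
    rcases hbad a b c h with rfl | rfl | rfl
    · exact ⟨b, c, h⟩
    · exfalso
      obtain ⟨h1, h2, h3, h4, h5, h6, -⟩ := h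
      rcases (gdeg_two' h5 h1 h2.symm h3 w).1 hzw with rfl | rfl
      · exact hw h4
      · exact hw h6
    · exact ⟨b, a, h.symm⟩
  obtain ⟨b, c, hzc, hzb, hbc, dz, db, dc, gz, gb, gc⟩ := hex
  have hbw : b ≠ w := by rintro rfl; exact hw db
  have Nz := gdeg_two' dz hbw hzb hzw
  have Nb := gdeg_two' db hzc hzb.symm hbc
  obtain ⟨x, hzx, hxb, hxw⟩ := exists_third gz b w
  have hxP : x ∉ P := fun h => hxw (hGP x hzx h)
  have hxz : x ≠ z := hzx.ne.symm
  have hTzx : ¬ T.Adj z x := fun h => by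
    rcases (Nz x).1 h with h | h
    · exact hxb h
    · exact hxw h
  have hbP : b ∉ P := fun h => hbw (hGP b (hTG hzb) h)
  have hcP : c ∉ P := fun h => by
    rcases hTP c b hbc.symm h with h | h
    · exact hbP h
    · exact hzb.ne h.2.symm
  have hcz := hzc.symm
  have hbz := hzb.ne.symm
  have hwz := hzw.ne.symm
  have hcw : c ≠ w := by rintro rfl; exact hcP hwP
  have hbcne := hbc.ne
  by_cases hcase : ∃ q, (∀ y, T.Adj x y ↔ y = q) ∧ gdeg T q = 2
  · obtain ⟨q, Nx, dq⟩ := hcase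
    have hxq : T.Adj x q := (Nx q).2 rfl
    have hxqne := hxq.ne
    have hqz : q ≠ z := by rintro rfl; exact hTzx hxq.symm
    have hle : swapE T x q z x ≤ G := by
      intro a b hab
      rw [swapE_adj] at hab
      rcases hab with hab | ⟨⟨rfl, rfl⟩ | ⟨rfl, rfl⟩, _⟩
      · exact hTG hab.1
      · exact hzx
      · exact hzx.symm
    refine ⟨swapE T x q z x, hle, swapE_tree hT ?_, ?_⟩
    · intro h
      refine not_reach_of_closed {x} ?_ rfl ?_ h.symm
      · rintro p r hpr rfl
        rw [del_adj, Nx] at hpr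
        exact absurd (Or.inl ⟨rfl, hpr.1⟩) hpr.2
      · exact hxz.symm
    · have d1z : gdeg (swapE T x q z x) z = 3 := by
        apply gdeg_eq_three hbw hxb.symm hxw.symm
        intro y
        rw [swapE_adj, Nz]
        grind
      have d1x : gdeg (swapE T x q z x) x = 1 := by
        apply gdeg_eq_one (a := z)
        intro y
        rw [swapE_adj, Nx]
        grind
      have d1 : ∀ a, a ≠ z → gdeg (swapE T x q z x) a = 2 → gdeg T a = 2 := by
        intro a haz ha
        by_cases hax : a = x
        · subst hax; omega
        by_cases haq : a = q
        · rw [haq]; exact dq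
        rw [← ha]
        apply gdeg_congr
        intro y
        rw [swapE_adj]
        grind
      rw [good_iff]
      rintro a1 a2 a3 ⟨h1, h2, h3, h4, h5, h6, h7⟩
      have n1 : a1 ≠ z := by rintro rfl; omega
      have n2 : a2 ≠ z := by rintro rfl; omega
      have n3 : a3 ≠ z := by rintro rfl; omega
      rw [swapE_adj] at h2 h3
      have := hbad a1 a2 a3 ⟨h1, by grind, by grind, d1 _ n1 h4, d1 _ n2 h5, d1 _ n3 h6, h7⟩
      grind
  · have hle : swapE T b c z x ≤ G := by
      intro a b hab
      rw [swapE_adj] at hab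
      rcases hab with hab | ⟨⟨rfl, rfl⟩ | ⟨rfl, rfl⟩, _⟩
      · exact hTG hab.1
      · exact hzx
      · exact hzx.symm
    refine ⟨swapE T b c z x, hle, swapE_tree hT ?_, ?_⟩
    · refine not_reach_of_closed (insert z (insert b P)) ?_ (Or.inl rfl) ?_
      · rintro p r hpr hp
        rw [del_adj] at hpr
        simp only [Set.mem_insert_iff] at hp ⊢
        rcases hp with rfl | rfl | hp
        · have := (Nz r).1 hpr.1
          grind
        · have := (Nb r).1 hpr.1
          grind
        · have := hTP p r hpr.1 hp
          grind
      · simp [hxz, hxb, hxP]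
    · have d1z : gdeg (swapE T b c z x) z = 3 := by
        apply gdeg_eq_three hbw hxb.symm hxw.symm
        intro y
        rw [swapE_adj, Nz]
        grind
      have d1 : ∀ a, a ≠ z → a ≠ x → gdeg (swapE T b c z x) a = 2 → gdeg T a = 2 := by
        intro a haz hax ha
        by_cases hab : a = b
        · rw [hab]; exact db
        by_cases hac : a = c
        · rw [hac]; exact dc
        rw [← ha]
        apply gdeg_congr
        intro y
        rw [swapE_adj]
        grind
      have d1x : gdeg (swapE T b c z x) x = 2 → gdeg T x = 2 ∨
          ∀ y, (swapE T b c z x).Adj x y → y = z ∨ (gdeg (swapE T b c z x) y ≠ 2) := by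
        intro h
        by_cases hxc : x = c
        · left; rw [hxc]; exact dc
        right
        have Nx : ∀ y, (swapE T b c z x).Adj x y ↔ T.Adj x y ∨ y = z := by
          intro y; rw [swapE_adj]; grind
        have := gdeg_add (fun h => hTzx h.symm) Nx
        obtain ⟨q, hq⟩ := gdeg_one (H := T) (v := x) (by omega)
        intro y hy
        rw [Nx, hq] at hy
        rcases hy with rfl | rfl
        · right
          intro hy2
          have hxy : T.Adj x y := (hq y).2 rfl
          refine hcase ⟨y, hq, d1 y ?_ hxy.ne.symm hy2⟩
          rintro rfl
          exact hTzx hxy.symm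
        · left; rfl
      rw [good_iff]
      rintro a1 a2 a3 ⟨h1, h2, h3, h4, h5, h6, h7⟩
      have n1 : a1 ≠ z := by rintro rfl; omega
      have n2 : a2 ≠ z := by rintro rfl; omega
      have n3 : a3 ≠ z := by rintro rfl; omega
      have e1 : gdeg T a1 = 2 := by
        by_cases hx : a1 = x
        · subst hx
          have := d1x h4
          grind
        · exact d1 _ n1 hx h4
      have e2 : gdeg T a2 = 2 := by
        by_cases hx : a2 = x
        · subst hx
          have := d1x h5
          grind
        · exact d1 _ n2 hx h5
      have e3 : gdeg T a3 = 2 := by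
        by_cases hx : a3 = x
        · subst hx
          have := d1x h6
          have := h3.symm
          grind
        · exact d1 _ n3 hx h6
      rw [swapE_adj] at h2 h3
      have := hbad a1 a2 a3 ⟨h1, by grind, by grind, e1, e2, e3, h7⟩
      grind

theorem gdeg_exch {V : Type} [Fintype V] {H K : SimpleGraph V} {a p q : V} (hp : H.Adj a p)
    (hq : ¬ H.Adj a q) (h : ∀ x, K.Adj a x ↔ (H.Adj a x ∧ x ≠ p) ∨ x = q) :
    gdeg K a = gdeg H a := by
  rw [gdeg_eq, gdeg_eq,
    ← Set.ncard_exchange (s := H.neighborSet a) (a := q) (b := p) (by simpa using hq)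
      (by simpa using hp)]
  congr 1; ext x; simp [h]; tauto

/-- the edges of `G` within `S` -/
def rest {V : Type} (G : SimpleGraph V) (S : Set V) : SimpleGraph V where
  Adj a b := G.Adj a b ∧ a ∈ S ∧ b ∈ S
  symm := ⟨fun _ _ h => ⟨h.1.symm, h.2.2, h.2.1⟩⟩
  loopless := ⟨fun _ h => h.1.ne rfl⟩

theorem rest_adj {V : Type} {G : SimpleGraph V} {S : Set V} {a b : V} :
    (rest G S).Adj a b ↔ G.Adj a b ∧ a ∈ S ∧ b ∈ S := Iff.rfl

theorem leaf {V : Type} [Fintype V] {G T : SimpleGraph V} {u v : V} (hTG : T ≤ G)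
    (hT : TreeOn {v}ᶜ T) (huv : G.Adj u v)
    (hbad : ∀ a b c, a ≠ u → b ≠ u → c ≠ u → ¬ Bad G T a b c) :
    ∃ T : SimpleGraph V, T ≤ G ∧ T.IsTree ∧ GoodSubgraph G T := by
  have : Nonempty V := ⟨u⟩
  have hne := huv.ne
  have hv : ∀ x, ¬ T.Adj x v := fun x h => (hT.2.1 x v h).2 rfl
  have hv' : ∀ x, ¬ T.Adj v x := fun x h => (hT.2.1 v x h).1 rfl
  have htree : (T ⊔ edge u v).IsTree := by
    refine (hT.addLeaf (u := u) (v := v) hne (by simp)).isTree ?_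
    intro a
    by_cases h : a = v
    · exact Or.inl h
    · exact Or.inr h
  have dv : gdeg (T ⊔ edge u v) v = 1 := by
    apply gdeg_eq_one (a := u)
    intro x
    rw [add_adj]
    grind
  refine pendant (T := T ⊔ edge u v) ?_ htree u v {v} ?_ rfl hne ?_ ?_ ?_ ?_
  · intro a b hab
    rw [add_adj] at hab
    rcases hab with hab | ⟨⟨rfl, rfl⟩ | ⟨rfl, rfl⟩, _⟩
    · exact hTG hab
    · exact huv
    · exact huv.symm
  · rw [add_adj]; grind
  · intro x _ h; exact h
  · rintro a b hab rfl
    rw [add_adj] at hab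
    grind
  · omega
  · rintro a b c ⟨h1, h2, h3, h4, h5, h6, h7⟩
    by_contra hc
    push Not at hc
    have n1 : a ≠ v := by rintro rfl; omega
    have n2 : b ≠ v := by rintro rfl; omega
    have n3 : c ≠ v := by rintro rfl; omega
    have d : ∀ y, y ≠ v → y ≠ u → gdeg (T ⊔ edge u v) y = gdeg T y := by
      intro y h1 h2
      apply gdeg_congr
      intro x
      rw [add_adj]; grind
    rw [d _ n1 hc.1.symm] at h4
    rw [d _ n2 hc.2.1.symm] at h5
    rw [d _ n3 hc.2.2.symm] at h6
    rw [add_adj] at h2 h3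
    exact hbad a b c hc.1.symm hc.2.1.symm hc.2.2.symm
      ⟨h1, by grind, by grind, h4, h5, h6, h7⟩

/-- the reduction: delete `v` and join its two neighbours -/
theorem red1 {V : Type} [Fintype V] {G : SimpleGraph V} (hconn : G.Connected)
    (hmin : ∀ (W : Type) [Fintype W] (G' : SimpleGraph W),
      Fintype.card W < Fintype.card V → G'.Connected →
      ∃ T : SimpleGraph W, T ≤ G' ∧ T.IsTree ∧ GoodSubgraph G' T)
    {u v w : V} (hvu : G.Adj v u) (hvw : G.Adj v w) (hv : ∀ x, G.Adj v x → x = u ∨ x = w) :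
    ∃ T : SimpleGraph V, T ≤ rest G {v}ᶜ ⊔ edge u w ∧ TreeOn {v}ᶜ T ∧
      GoodSubgraph (rest G {v}ᶜ ⊔ edge u w) T := by
  classical
  have hu := hvu.ne
  have hw := hvw.ne
  refine transfer hmin {v}ᶜ _ v u (by simp) hu.symm ?_ ?_
  · intro a b hab
    rw [add_adj, rest_adj] at hab
    simp only [Set.mem_compl_iff, Set.mem_singleton_iff] at hab ⊢
    grind
  · intro a ha b hb
    have hE : (rest G {v}ᶜ ⊔ edge u w).Reachable u w := by
      by_cases huw : u = w
      · rw [huw]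
      · apply Adj.reachable; rw [add_adj]; exact Or.inr ⟨Or.inl ⟨rfl, rfl⟩, huw⟩
    have := reach_map (H := rest G {v}ᶜ ⊔ edge u w) (fun x => if x = v then u else x)
      (fun p q hpq => by
        by_cases hp : p = v
        · subst hp
          have hq := hpq.ne.symm
          simp only [if_true, if_neg hq]
          rcases hv q hpq with rfl | rfl
          · exact Reachable.refl _
          · exact hE
        by_cases hq : q = v
        · subst hq
          simp only [if_true, if_neg hp]
          rcases hv p hpq.symm with rfl | rfl
          · exact Reachable.refl _
          · exact hE.symm
        simp only [if_neg hp, if_neg hq]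
        apply Adj.reachable; rw [add_adj, rest_adj]; exact Or.inl ⟨hpq, hp, hq⟩)
      (hconn.preconnected a b)
    simpa only [if_neg (show ¬ a = v from ha), if_neg (show ¬ b = v from hb)] using this

theorem caseA {V : Type} [Fintype V] {G : SimpleGraph V} (hconn : G.Connected)
    (hmin : ∀ (W : Type) [Fintype W] (G' : SimpleGraph W),
      Fintype.card W < Fintype.card V → G'.Connected →
      ∃ T : SimpleGraph W, T ≤ G' ∧ T.IsTree ∧ GoodSubgraph G' T)
    {u v w : V} (hvu : G.Adj v u) (hvw : G.Adj v w) (hv : ∀ x, G.Adj v x → x = u ∨ x = w)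
    (huw : ¬ G.Adj u w) :
    ∃ T : SimpleGraph V, T ≤ G ∧ T.IsTree ∧ GoodSubgraph G T := by
  obtain ⟨T, hTH, hT, hgood⟩ := red1 hconn hmin hvu hvw hv
  have hu := hvu.ne
  have hw := hvw.ne
  have hTv : ∀ x, ¬ T.Adj x v := fun x h => (hT.2.1 x v h).2 rfl
  have hTv' : ∀ x, ¬ T.Adj v x := fun x h => (hT.2.1 v x h).1 rfl
  have hTadj : ∀ a b, T.Adj a b → G.Adj a b ∨ (a = u ∧ b = w ∨ a = w ∧ b = u) := by
    intro a b hab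
    have := hTH hab
    rw [add_adj, rest_adj] at this
    tauto
  have dG : ∀ a, a ≠ v → (a ≠ u ∨ u ≠ w) → gdeg (rest G {v}ᶜ ⊔ edge u w) a = gdeg G a := by
    intro a hav h
    have huw' : ¬ G.Adj w u := fun h => huw h.symm
    by_cases hau : a = u
    · subst hau
      apply gdeg_exch hvu.symm huw
      intro x
      rw [add_adj, rest_adj]
      simp only [Set.mem_compl_iff, Set.mem_singleton_iff]
      grind
    by_cases haw : a = w
    · subst haw
      apply gdeg_exch hvw.symm huw'
      intro x
      rw [add_adj, rest_adj]
      simp only [Set.mem_compl_iff, Set.mem_singleton_iff]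
      grind
    apply gdeg_congr
    intro x
    rw [add_adj, rest_adj]
    simp only [Set.mem_compl_iff, Set.mem_singleton_iff]
    have : a ≠ v := hav
    constructor
    · grind
    · intro hx
      left
      refine ⟨hx, hav, ?_⟩
      rintro rfl
      have := hv a hx.symm
      tauto
  rw [good_iff] at hgood
  by_cases huwT : T.Adj u w
  · have hne := huwT.ne
    have : Nonempty V := ⟨u⟩
    have htree : (T ⊔ edge u v).IsTree := by
      refine (hT.addLeaf (u := u) (v := v) hu.symm (by simp)).isTree ?_
      intro a
      by_cases h : a = v
      · exact Or.inl h
      · exact Or.inr h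
    have A : (T ⊔ edge u v).Adj u w := by rw [add_adj]; exact Or.inl huwT
    have hadj : ∀ x y, (swapE (T ⊔ edge u v) u w v w).Adj x y ↔
        (T.Adj x y ∧ ¬ (x = u ∧ y = w ∨ x = w ∧ y = u)) ∨ (x = v ∧ (y = u ∨ y = w)) ∨
          (y = v ∧ (x = u ∨ x = w)) := by
      intro x y
      rw [swapE_adj, add_adj]
      grind
    refine ⟨swapE (T ⊔ edge u v) u w v w, ?_, swapE_tree htree ?_, ?_⟩
    · intro a b hab
      rw [hadj] at hab
      have := hTadj a b
      have := hvu.symm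
      have := hvw.symm
      grind
    · intro h
      refine bridge_of_tree htree.2 A (Reachable.trans (Adj.reachable ?_) h)
      rw [del_adj, add_adj]
      grind
    · rw [good_iff]
      rintro a b c ⟨h1, h2, h3, h4, h5, h6, h7, h8, h9⟩
      have nv : ∀ a, 3 ≤ gdeg G a → a ≠ v := by
        rintro a h rfl
        obtain ⟨x, hx, h1, h2⟩ := exists_third h u w
        have := hv x hx
        tauto
      have d : ∀ y, y ≠ v → gdeg (swapE (T ⊔ edge u v) u w v w) y = gdeg T y := by
        intro y hy
        by_cases hyu : y = u
        · subst hyu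
          apply gdeg_exch huwT (hTv _)
          intro x; rw [hadj]; grind
        by_cases hyw : y = w
        · subst hyw
          apply gdeg_exch huwT.symm (hTv _)
          intro x; rw [hadj]; grind
        apply gdeg_congr
        intro x; rw [hadj]; grind
      have n1 := nv a h7
      have n2 := nv b h8
      have n3 := nv c h9
      rw [d _ n1] at h4
      rw [d _ n2] at h5
      rw [d _ n3] at h6
      rw [← dG _ n1 (Or.inr hne)] at h7
      rw [← dG _ n2 (Or.inr hne)] at h8
      rw [← dG _ n3 (Or.inr hne)] at h9
      rw [hadj] at h2 h3
      exact hgood a b c ⟨h1, by grind, by grind, h4, h5, h6, h7, h8, h9⟩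
  · refine leaf (u := u) (v := v) ?_ hT hvu.symm ?_
    · intro a b hab
      rcases hTadj a b hab with h | ⟨rfl, rfl⟩ | ⟨rfl, rfl⟩
      · exact h
      · exact absurd hab huwT
      · exact absurd hab.symm huwT
    · rintro a b c n1 n2 n3 ⟨h1, h2, h3, h4, h5, h6, h7, h8, h9⟩
      have m1 : a ≠ v := by rintro rfl; exact hTv' _ h2
      have m2 : b ≠ v := by rintro rfl; exact hTv' _ h3
      have m3 : c ≠ v := by rintro rfl; exact hTv _ h3
      rw [← dG _ m1 (Or.inl n1)] at h7
      rw [← dG _ m2 (Or.inl n2)] at h8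
      rw [← dG _ m3 (Or.inl n3)] at h9
      exact hgood a b c ⟨h1, h2, h3, h4, h5, h6, h7, h8, h9⟩

theorem sideB {V : Type} [Fintype V] {G T : SimpleGraph V}
    {u v w : V} (hvu : G.Adj v u) (hvw : G.Adj v w) (hv : ∀ x, G.Adj v x → x = u ∨ x = w)
    (huw : G.Adj u w) (hTR : T ≤ rest G {v}ᶜ) (hT : TreeOn {v}ᶜ T)
    (hgood : GoodSubgraph (rest G {v}ᶜ) T) :
    (∃ T : SimpleGraph V, T ≤ G ∧ T.IsTree ∧ GoodSubgraph G T) ∨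
    ∃ z, z ≠ u ∧ z ≠ v ∧ z ≠ w ∧ (∀ x, G.Adj w x ↔ x = u ∨ x = v ∨ x = z) ∧ T.Adj w u ∧
      T.Adj w z ∧ gdeg T z = 2 := by
  by_cases hall : ∀ a b c, a ≠ u → b ≠ u → c ≠ u → ¬ Bad G T a b c
  · left
    exact leaf (fun a b hab => (hTR hab).1) hT hvu.symm hall
  right
  push Not at hall
  obtain ⟨a, b, c, na, nb, nc, hB⟩ := hall
  rw [good_iff] at hgood
  have hTv : ∀ x, ¬ T.Adj x v := fun x h => (hT.2.1 x v h).2 rfl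
  have hTv' : ∀ x, ¬ T.Adj v x := fun x h => (hT.2.1 v x h).1 rfl
  have dR : ∀ y, y ≠ v → y ≠ u → y ≠ w → gdeg (rest G {v}ᶜ) y = gdeg G y := by
    intro y h1 h2 h3
    apply gdeg_congr
    intro x
    rw [rest_adj]
    refine ⟨fun h => h.1, fun h => ⟨h, h1, ?_⟩⟩
    rintro rfl
    have := hv y h.symm
    tauto
  have dw : gdeg (rest G {v}ᶜ) w ≤ 2 ∧ (w = a ∨ w = b ∨ w = c) := by
    by_contra hcon
    obtain ⟨h1, h2, h3, h4, h5, h6, h7, h8, h9⟩ := hB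
    have m1 : a ≠ v := by rintro rfl; exact hTv' _ h2
    have m2 : b ≠ v := by rintro rfl; exact hTv' _ h3
    have m3 : c ≠ v := by rintro rfl; exact hTv _ h3
    have key : ∀ y, (y = a ∨ y = b ∨ y = c) → y ≠ v → y ≠ u → 3 ≤ gdeg G y →
        3 ≤ gdeg (rest G {v}ᶜ) y := by
      intro y hy hyv hyu h
      by_cases hyw : y = w
      · subst hyw
        by_contra h'
        exact hcon ⟨by omega, hy⟩
      · rw [dR y hyv hyu hyw]; exact h
    exact hgood a b c ⟨h1, h2, h3, h4, h5, h6, key a (by tauto) m1 na h7,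
      key b (by tauto) m2 nb h8, key c (by tauto) m3 nc h9⟩
  obtain ⟨dw, hmem⟩ := dw
  have hRwu : (rest G {v}ᶜ).Adj w u := ⟨huw.symm, hvw.ne.symm, hvu.ne.symm⟩
  have hTw : gdeg T w = 2 → ∀ x, T.Adj w x ↔ (rest G {v}ᶜ).Adj w x := by
    intro h x
    have : T.neighborSet w = (rest G {v}ᶜ).neighborSet w := by
      have hsub : T.neighborSet w ⊆ (rest G {v}ᶜ).neighborSet w := fun x hx => hTR hx
      have hcard : ((rest G {v}ᶜ).neighborSet w).ncard ≤ (T.neighborSet w).ncard := by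
        rw [← gdeg_eq, ← gdeg_eq, h]; exact dw
      exact Set.eq_of_subset_of_ncard_le hsub hcard (Set.toFinite _)
    exact Set.ext_iff.1 this x
  have hex : ∃ b c, b ≠ u ∧ Bad G T w b c := by
    rcases hmem with rfl | rfl | rfl
    · exact ⟨b, c, nb, hB⟩
    · exfalso
      obtain ⟨h1, h2, h3, h4, h5, -⟩ := hB
      have := (gdeg_two' h5 h1 h2.symm h3 u).1 ((hTw h5 u).2 hRwu)
      tauto
    · exact ⟨b, a, nb, hB.symm⟩
  obtain ⟨z, c, hzu, -, h2, h3, h4, h5, -⟩ := hex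
  have hwu := (hTw h4 u).2 hRwu
  refine ⟨z, hzu, ?_, h2.ne.symm, ?_, hwu, h2, h5⟩
  · rintro rfl; exact hTv _ h2
  · intro x
    have e1 := gdeg_two' h4 hzu h2 hwu x
    rw [hTw h4, rest_adj] at e1
    by_cases hxv : x = v
    · subst hxv; simp [hvw.symm]
    · have m : w ∈ ({v}ᶜ : Set V) := hvw.ne.symm
      have m' : x ∈ ({v}ᶜ : Set V) := hxv
      tauto

/-- hang the triangle on `z` -/
def hang {V : Type} (T : SimpleGraph V) (u v w z : V) : SimpleGraph V :=
  T ⊔ edge z w ⊔ edge w u ⊔ edge w v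

theorem hang_adj {V : Type} {T : SimpleGraph V} {u v w z : V} (huv : u ≠ v) (huw : u ≠ w)
    (hvw : v ≠ w) (hzw : z ≠ w) (x y : V) : (hang T u v w z).Adj x y ↔ T.Adj x y ∨
      (x = w ∧ (y = z ∨ y = u ∨ y = v)) ∨ (y = w ∧ (x = z ∨ x = u ∨ x = v)) := by
  rw [hang, add_adj, add_adj, add_adj]
  grind

theorem hang_tree {V : Type} {T : SimpleGraph V} {S : Set V} {u v w z : V} (huv : u ≠ v)
    (huw : u ≠ w) (hvw : v ≠ w) (hS : ∀ x, x ∈ S ↔ x ≠ u ∧ x ≠ v ∧ x ≠ w) (hT : TreeOn S T)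
    (hz : z ∈ S) : (hang T u v w z).IsTree := by
  have : Nonempty V := ⟨u⟩
  have h1 := hT.addLeaf (u := z) (v := w) hz (by simp [hS])
  have h2 := h1.addLeaf (u := w) (v := u) (by simp) (by simp [hS, huw])
  have h3 := h2.addLeaf (u := w) (v := v) (by simp) (by simp [hS, huv.symm, hvw])
  refine h3.isTree ?_
  intro a
  simp only [Set.mem_insert_iff, hS]
  tauto

theorem sideC {V : Type} [Fintype V] {G T : SimpleGraph V} {S : Set V} {u v w z z' : V}
    (huv : u ≠ v) (huw : u ≠ w) (hvw : v ≠ w) (hzz : z ≠ z')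
    (hS : ∀ x, x ∈ S ↔ x ≠ u ∧ x ≠ v ∧ x ≠ w) (hT : TreeOn S T) (hz : z ∈ S) (hz' : z' ∈ S)
    (Nv : ∀ x, G.Adj v x ↔ x = u ∨ x = w)
    (Nu : ∀ x, G.Adj u x ↔ x = v ∨ x = w ∨ x = z')
    (Nw : ∀ x, G.Adj w x ↔ x = v ∨ x = u ∨ x = z)
    (hTadj : ∀ a b, T.Adj a b → G.Adj a b ∨ (a = z ∧ b = z' ∨ a = z' ∧ b = z))
    (hgood : ∀ a b c, ¬ Bad G T a b c) (hTz : T.Adj z z') :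
    (∃ T : SimpleGraph V, T ≤ G ∧ T.IsTree ∧ GoodSubgraph G T) ∨
    (gdeg T z' = 2 ∧ 3 ≤ gdeg G z' ∧ ∃ y, y ≠ z ∧ T.Adj z' y ∧ gdeg T y = 2 ∧ 3 ≤ gdeg G y) := by
  have hTu : ∀ x, ¬ T.Adj u x := fun x h => ((hS _).1 (hT.2.1 _ _ h).1).1 rfl
  have hTv : ∀ x, ¬ T.Adj v x := fun x h => ((hS _).1 (hT.2.1 _ _ h).1).2.1 rfl
  have hTw : ∀ x, ¬ T.Adj w x := fun x h => ((hS _).1 (hT.2.1 _ _ h).1).2.2 rfl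
  have hTu' : ∀ x, ¬ T.Adj x u := fun x h => hTu x h.symm
  have hTv' : ∀ x, ¬ T.Adj x v := fun x h => hTv x h.symm
  have hTw' : ∀ x, ¬ T.Adj x w := fun x h => hTw x h.symm
  obtain ⟨zu, zv, zw⟩ := (hS z).1 hz
  obtain ⟨zu', zv', zw'⟩ := (hS z').1 hz'
  have hadj : ∀ x y, (swapE (hang T u v w z) z z' u z').Adj x y ↔
      (T.Adj x y ∧ ¬ (x = z ∧ y = z' ∨ x = z' ∧ y = z)) ∨
      (x = w ∧ (y = z ∨ y = u ∨ y = v)) ∨ (y = w ∧ (x = z ∨ x = u ∨ x = v)) ∨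
      (x = u ∧ y = z') ∨ (x = z' ∧ y = u) := by
    intro x y
    rw [swapE_adj, hang_adj huv huw hvw zw]
    grind
  have ht := hang_tree huv huw hvw hS hT hz
  have htree : (swapE (hang T u v w z) z z' u z').IsTree := by
    refine swapE_tree ht ?_
    intro h
    refine bridge_of_tree ht.2 (b := z) (c := z') ?_ ?_
    · rw [hang_adj huv huw hvw zw]; exact Or.inl hTz
    · refine Reachable.trans (Adj.reachable (v := w) ?_)
        (Reachable.trans (Adj.reachable (v := u) ?_) h)
      · rw [del_adj, hang_adj huv huw hvw zw]; grind
      · rw [del_adj, hang_adj huv huw hvw zw]; grind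
  by_cases hg : GoodSubgraph G (swapE (hang T u v w z) z z' u z')
  · left
    refine ⟨_, ?_, htree, hg⟩
    intro a b hab
    rw [hadj] at hab
    have e1 := hTadj a b
    have e2 := Nu a
    have e3 := Nw a
    have e4 := Nu b
    have e5 := Nw b
    have e6 := G.adj_comm a b
    grind
  right
  rw [good_iff] at hg
  push Not at hg
  obtain ⟨a, b, c, hB⟩ := hg
  have dw : gdeg (swapE (hang T u v w z) z z' u z') w = 3 := by
    apply gdeg_eq_three (a := z) (b := u) (c := v) zu zv huv
    intro x; rw [hadj]; grind
  have dv : gdeg (swapE (hang T u v w z) z z' u z') v = 1 := by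
    apply gdeg_eq_one (a := w)
    intro x; rw [hadj]; grind
  have d : ∀ y, y ≠ u → y ≠ v → y ≠ w → gdeg (swapE (hang T u v w z) z z' u z') y = gdeg T y := by
    intro y h1 h2 h3
    by_cases hyz : y = z
    · subst hyz
      apply gdeg_exch hTz (hTw' _)
      intro x; rw [hadj]; grind
    by_cases hyz' : y = z'
    · subst hyz'
      apply gdeg_exch hTz.symm (hTu' _)
      intro x; rw [hadj]; grind
    apply gdeg_congr
    intro x; rw [hadj]; grind
  have nvw : ∀ y, gdeg (swapE (hang T u v w z) z z' u z') y = 2 → y ≠ v ∧ y ≠ w := by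
    intro y hy
    constructor <;> (rintro rfl; omega)
  have hex : ∃ b c, Bad G (swapE (hang T u v w z) z z' u z') u b c := by
    by_cases hau : a = u
    · subst hau; exact ⟨b, c, hB⟩
    by_cases hcu : c = u
    · subst hcu; exact ⟨b, a, hB.symm⟩
    exfalso
    obtain ⟨h1, h2, h3, h4, h5, h6, h7⟩ := hB
    have n1 := nvw a h4
    have n2 := nvw b h5
    have n3 := nvw c h6
    rw [hadj] at h2 h3
    by_cases hbu : b = u
    · subst hbu
      grind
    rw [d _ hau n1.1 n1.2] at h4
    rw [d _ hbu n2.1 n2.2] at h5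
    rw [d _ hcu n3.1 n3.2] at h6
    exact hgood a b c ⟨h1, by grind, by grind, h4, h5, h6, h7⟩
  clear hB a b c
  obtain ⟨b, y, h1, h2, h3, h4, h5, h6, h7, h8, h9⟩ := hex
  have n2 := nvw b h5
  have n3 := nvw y h6
  rw [hadj] at h2 h3
  have hb : b = z' := by grind
  subst hb
  rw [d _ zu' zv' zw'] at h5
  rw [d _ h1.symm n3.1 n3.2] at h6
  refine ⟨h5, h8, y, ?_, ?_, h6, h9⟩ <;> grind

theorem caseC {V : Type} [Fintype V] {G : SimpleGraph V} (hconn : G.Connected)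
    (hmin : ∀ (W : Type) [Fintype W] (G' : SimpleGraph W),
      Fintype.card W < Fintype.card V → G'.Connected →
      ∃ T : SimpleGraph W, T ≤ G' ∧ T.IsTree ∧ GoodSubgraph G' T)
    {u v w z z' : V} (huv : u ≠ v) (huw : u ≠ w) (hvw : v ≠ w) (hzz : z ≠ z')
    (zu : z ≠ u) (zv : z ≠ v) (zw : z ≠ w) (zu' : z' ≠ u) (zv' : z' ≠ v) (zw' : z' ≠ w)
    (Nv : ∀ x, G.Adj v x ↔ x = u ∨ x = w)
    (Nu : ∀ x, G.Adj u x ↔ x = v ∨ x = w ∨ x = z')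
    (Nw : ∀ x, G.Adj w x ↔ x = v ∨ x = u ∨ x = z)
    (hGz : ¬ G.Adj z z') :
    ∃ T : SimpleGraph V, T ≤ G ∧ T.IsTree ∧ GoodSubgraph G T := by
  classical
  obtain ⟨S, hS⟩ : ∃ S : Set V, ∀ x, x ∈ S ↔ x ≠ u ∧ x ≠ v ∧ x ≠ w :=
    ⟨{x | x ≠ u ∧ x ≠ v ∧ x ≠ w}, fun x => Iff.rfl⟩
  have hz : z ∈ S := (hS z).2 ⟨zu, zv, zw⟩
  have hz' : z' ∈ S := (hS z').2 ⟨zu', zv', zw'⟩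
  have hGz' : ¬ G.Adj z' z := fun h => hGz h.symm
  have Nv' : ∀ x, G.Adj x v ↔ x = u ∨ x = w := fun x => by rw [G.adj_comm, Nv]
  have Nu' : ∀ x, G.Adj x u ↔ x = v ∨ x = w ∨ x = z' := fun x => by rw [G.adj_comm, Nu]
  have Nw' : ∀ x, G.Adj x w ↔ x = v ∨ x = u ∨ x = z := fun x => by rw [G.adj_comm, Nw]
  have hHadj : ∀ a b, (rest G S ⊔ edge z z').Adj a b ↔
      (G.Adj a b ∧ a ∈ S ∧ b ∈ S) ∨ (a = z ∧ b = z' ∨ a = z' ∧ b = z) := by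
    intro a b
    rw [add_adj, rest_adj]
    grind
  obtain ⟨T, hTH, hT, hgood⟩ := transfer hmin S (rest G S ⊔ edge z z') v z
    (by simp [hS]) hz (by intro a b hab; rw [hHadj] at hab; grind) (by
      intro a ha b hb
      have hE : (rest G S ⊔ edge z z').Reachable z z' := by
        apply Adj.reachable; rw [hHadj]; simp
      have hE' := hE.symm
      let f : V → V := fun x => if x = u then z' else if x = v ∨ x = w then z else x
      have fu : f u = z' := by simp [f]
      have fv : f v = z := by simp [f, huv.symm]
      have fw : f w = z := by simp [f, huw.symm]
      have fS : ∀ x, x ∈ S → f x = x := by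
        intro x hx
        have := (hS x).1 hx
        simp [f, this]
      have hrefl : ∀ x, (rest G S ⊔ edge z z').Reachable x x := fun x => Reachable.refl _
      have fz := fS z hz
      have fz' := fS z' hz'
      have := reach_map (H := rest G S ⊔ edge z z') f (fun p q hpq => by
        by_cases hp : p ∈ S
        · by_cases hq : q ∈ S
          · rw [fS p hp, fS q hq]
            apply Adj.reachable; rw [hHadj]; exact Or.inl ⟨hpq, hp, hq⟩
          · rw [hS] at hq
            have e1 := Nu' p
            have e2 := Nv' p
            have e3 := Nw' p
            grind
        · rw [hS] at hp
          have e1 := Nu q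
          have e2 := Nv q
          have e3 := Nw q
          grind)
        (hconn.preconnected a b)
      rwa [fS a ha, fS b hb] at this)
  have dG : ∀ a, a ∈ S → gdeg (rest G S ⊔ edge z z') a = gdeg G a := by
    intro a ha
    have haS := (hS a).1 ha
    by_cases haz : a = z
    · subst haz
      apply gdeg_exch (p := w) (q := z') ((Nw' _).2 (by simp)) hGz
      intro x; rw [hHadj]
      have e1 := Nu' a
      have e2 := Nv' a
      have e3 := hS x
      grind
    by_cases haz' : a = z'
    · subst haz'
      apply gdeg_exch (p := u) (q := z) ((Nu' _).2 (by simp)) hGz'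
      intro x; rw [hHadj]
      have e1 := Nw' a
      have e2 := Nv' a
      have e3 := hS x
      grind
    apply gdeg_congr
    intro x; rw [hHadj]
    have e0 := Nu' a
    have e1 := Nw' a
    have e2 := Nv' a
    have e3 := hS x
    grind
  have hTadj : ∀ a b, T.Adj a b → G.Adj a b ∨ (a = z ∧ b = z' ∨ a = z' ∧ b = z) := by
    intro a b hab
    have := (hHadj a b).1 (hTH hab)
    tauto
  have hgood' : ∀ a b c, ¬ Bad G T a b c := by
    rw [good_iff] at hgood
    rintro a b c ⟨h1, h2, h3, h4, h5, h6, h7, h8, h9⟩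
    have m1 := hT.2.1 _ _ h2
    have m2 := hT.2.1 _ _ h3
    rw [← dG _ m1.1] at h7
    rw [← dG _ m1.2] at h8
    rw [← dG _ m2.2] at h9
    exact hgood a b c ⟨h1, h2, h3, h4, h5, h6, h7, h8, h9⟩
  by_cases hTz : T.Adj z z'
  · rcases sideC huv huw hvw hzz hS hT hz hz' Nv Nu Nw hTadj hgood' hTz with h | h
    · exact h
    rcases sideC (u := w) (w := u) (z := z') (z' := z) hvw.symm huw.symm huv.symm hzz.symm
      (fun x => by rw [hS]; tauto) hT hz' hz (fun x => by rw [Nv]; tauto) Nw Nu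
      (fun a b hab => by have := hTadj a b hab; tauto) hgood' hTz.symm with h' | h'
    · exact h'
    exfalso
    obtain ⟨h1, h2, y, hy, h3, h4, h5⟩ := h
    exact hgood' z z' y ⟨hy.symm, hTz, h3, h'.1, h1, h4, h'.2.1, h2, h5⟩
  · have hTu : ∀ x, ¬ T.Adj u x := fun x h => ((hS _).1 (hT.2.1 _ _ h).1).1 rfl
    have hTv : ∀ x, ¬ T.Adj v x := fun x h => ((hS _).1 (hT.2.1 _ _ h).1).2.1 rfl
    have hTw : ∀ x, ¬ T.Adj w x := fun x h => ((hS _).1 (hT.2.1 _ _ h).1).2.2 rfl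
    have hTu' : ∀ x, ¬ T.Adj x u := fun x h => hTu x h.symm
    have hTv' : ∀ x, ¬ T.Adj x v := fun x h => hTv x h.symm
    have hTw' : ∀ x, ¬ T.Adj x w := fun x h => hTw x h.symm
    have hadj := hang_adj (T := T) huv huw hvw zw
    have dw : gdeg (hang T u v w z) w = 3 := by
      apply gdeg_eq_three (a := z) (b := u) (c := v) zu zv huv
      intro x; rw [hadj]; grind
    have dv : gdeg (hang T u v w z) v = 1 := by
      apply gdeg_eq_one (a := w)
      intro x; rw [hadj]; grind
    have du : gdeg (hang T u v w z) u = 1 := by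
      apply gdeg_eq_one (a := w)
      intro x; rw [hadj]; grind
    refine pendant (T := hang T u v w z) ?_ (hang_tree huv huw hvw hS hT hz) z w {u, v, w}
      ?_ (by simp) (by simp [zu, zv, zw]) ?_ ?_ (by omega) ?_
    · intro a b hab
      rw [hadj] at hab
      have e1 := hTadj a b
      have e2 := T.adj_comm a b
      have e3 := Nw a
      have e4 := Nw b
      have e5 := G.adj_comm a b
      grind
    · rw [hadj]; simp
    · intro x hx hxP
      simp only [Set.mem_insert_iff, Set.mem_singleton_iff] at hxP
      have e1 := Nu' z
      have e2 := Nv' z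
      grind
    · intro a b hab haP
      simp only [Set.mem_insert_iff, Set.mem_singleton_iff] at haP ⊢
      rw [hadj] at hab
      grind
    · rintro a b c ⟨h1, h2, h3, h4, h5, h6, h7⟩
      by_contra hc
      push Not at hc
      have hn : ∀ y, gdeg (hang T u v w z) y = 2 → y ≠ u ∧ y ≠ v ∧ y ≠ w := by
        intro y hy
        refine ⟨?_, ?_, ?_⟩ <;> (rintro rfl; omega)
      have d : ∀ y, z ≠ y → gdeg (hang T u v w z) y = 2 → gdeg T y = 2 := by
        intro y hy h
        have := hn y h
        rw [← h]
        apply gdeg_congr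
        intro x; rw [hadj]; grind
      have n1 := hn a h4
      have n2 := hn b h5
      have n3 := hn c h6
      rw [hadj] at h2 h3
      exact hgood' a b c ⟨h1, by grind, by grind, d _ hc.1 h4, d _ hc.2.1 h5, d _ hc.2.2 h6, h7⟩

theorem caseB {V : Type} [Fintype V] {G : SimpleGraph V} (hconn : G.Connected)
    (hmin : ∀ (W : Type) [Fintype W] (G' : SimpleGraph W),
      Fintype.card W < Fintype.card V → G'.Connected →
      ∃ T : SimpleGraph W, T ≤ G' ∧ T.IsTree ∧ GoodSubgraph G' T)
    {u v w : V} (hvu : G.Adj v u) (hvw : G.Adj v w) (hv : ∀ x, G.Adj v x → x = u ∨ x = w)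
    (huw : G.Adj u w) :
    ∃ T : SimpleGraph V, T ≤ G ∧ T.IsTree ∧ GoodSubgraph G T := by
  obtain ⟨T, hTR, hT, hgood⟩ := red1 hconn hmin hvu hvw hv
  have hR : rest G {v}ᶜ ⊔ edge u w = rest G {v}ᶜ := by
    ext a b
    rw [add_adj]
    constructor
    · rintro (h | ⟨⟨rfl, rfl⟩ | ⟨rfl, rfl⟩, _⟩)
      · exact h
      · exact ⟨huw, hvu.ne.symm, hvw.ne.symm⟩
      · exact ⟨huw.symm, hvw.ne.symm, hvu.ne.symm⟩
    · exact Or.inl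
  rw [hR] at hTR hgood
  rcases sideB hvu hvw hv huw hTR hT hgood with h | ⟨z, zu, zv, zw, Nw, hTwu, hTwz, dz⟩
  · exact h
  rcases sideB hvw hvu (fun x hx => (hv x hx).symm) huw.symm hTR hT hgood with
    h | ⟨z', zw', zv', zu', Nu, hTuw, hTuz, dz'⟩
  · exact h
  have hu := hvu.ne
  have hw := hvw.ne
  have hne := huw.ne
  have hzz : z ≠ z' := by
    rintro rfl
    refine bridge_of_tree hT.1 hTuw ?_
    refine Reachable.trans (Adj.reachable (v := z) ?_) (Adj.reachable ?_)
    · rw [del_adj]; grind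
    · rw [del_adj]; have := hTwz.symm; grind
  have Nv : ∀ x, G.Adj v x ↔ x = u ∨ x = w := fun x =>
    ⟨hv x, by rintro (rfl | rfl) <;> assumption⟩
  by_cases hGz : G.Adj z z'
  swap
  · exact caseC hconn hmin hu.symm hne hw hzz zu zv zw zu' zv' zw' Nv
      (fun x => by rw [Nu]; tauto) (fun x => by rw [Nw]; tauto) hGz
  have : Nonempty V := ⟨u⟩
  have hTv : ∀ x, ¬ T.Adj x v := fun x h => (hT.2.1 x v h).2 rfl
  have hTv' : ∀ x, ¬ T.Adj v x := fun x h => (hT.2.1 v x h).1 rfl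
  have htree : (T ⊔ edge w v).IsTree := by
    refine (hT.addLeaf (u := w) (v := v) hw.symm (by simp)).isTree ?_
    intro a
    by_cases h : a = v
    · exact Or.inl h
    · exact Or.inr h
  have hTG : ∀ a b, T.Adj a b → G.Adj a b := fun a b h => (hTR h).1
  have hTzz : ¬ T.Adj z z' := by
    intro h
    refine bridge_of_tree hT.1 hTuw ?_
    refine Reachable.trans (Adj.reachable (v := z') ?_)
      (Reachable.trans (Adj.reachable (v := z) ?_) (Adj.reachable ?_))
    · rw [del_adj]; grind
    · rw [del_adj]; have := h.symm; grind
    · rw [del_adj]; have := hTwz.symm; grind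
  have hTzz' : ¬ T.Adj z' z := fun h => hTzz h.symm
  have hadj : ∀ x y, (swapE (T ⊔ edge w v) u w z z').Adj x y ↔
      (T.Adj x y ∧ ¬ (x = u ∧ y = w ∨ x = w ∧ y = u)) ∨ (x = w ∧ y = v) ∨ (x = v ∧ y = w) ∨
      (x = z ∧ y = z') ∨ (x = z' ∧ y = z) := by
    intro x y
    rw [swapE_adj, add_adj]
    grind
  refine ⟨swapE (T ⊔ edge w v) u w z z', ?_, swapE_tree htree ?_, ?_⟩
  · intro a b hab
    rw [hadj] at hab
    have := hTG a b
    have := hvw.symm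
    have := hGz.symm
    grind
  · intro h
    refine bridge_of_tree htree.2 (b := u) (c := w) ?_ ?_
    · rw [add_adj]; exact Or.inl hTuw
    · refine Reachable.trans (Adj.reachable (v := z') ?_)
        (Reachable.trans h.symm (Adj.reachable ?_))
      · rw [del_adj, add_adj]; grind
      · rw [del_adj, add_adj]; have := hTwz.symm; grind
  · rw [good_iff] at hgood ⊢
    have d1z : gdeg (swapE (T ⊔ edge w v) u w z z') z = 3 := by
      have := gdeg_add (H := T) (K := swapE (T ⊔ edge w v) u w z z') hTzz
        (fun x => by rw [hadj]; grind)
      omega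
    have d1z' : gdeg (swapE (T ⊔ edge w v) u w z z') z' = 3 := by
      have := gdeg_add (H := T) (K := swapE (T ⊔ edge w v) u w z z') hTzz'
        (fun x => by rw [hadj]; grind)
      omega
    have d1v : gdeg (swapE (T ⊔ edge w v) u w z z') v = 1 := by
      apply gdeg_eq_one (a := w)
      intro x; rw [hadj]; grind
    have d1u : gdeg (swapE (T ⊔ edge w v) u w z z') u = 1 := by
      apply gdeg_eq_one (a := z')
      intro x; rw [hadj]
      have e := Nu x
      have e2 := hTG u x
      have e3 := hTv u
      grind
    have nw : ∀ x, (swapE (T ⊔ edge w v) u w z z').Adj w x → x = v ∨ x = z := by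
      intro x; rw [hadj]
      have e := Nw x
      have e2 := hTG w x
      grind
    have hn : ∀ y, gdeg (swapE (T ⊔ edge w v) u w z z') y = 2 →
        y ≠ z ∧ y ≠ z' ∧ y ≠ v ∧ y ≠ u := by
      intro y hy
      refine ⟨?_, ?_, ?_, ?_⟩ <;> (rintro rfl; omega)
    rintro a b c ⟨h1, h2, h3, h4, h5, h6, h7, h8, h9⟩
    have n1 := hn a h4
    have n2 := hn b h5
    have n3 := hn c h6
    have m1 : a ≠ w := by rintro rfl; have := nw _ h2; tauto
    have m2 : b ≠ w := by rintro rfl; have := nw _ h3; tauto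
    have m3 : c ≠ w := by rintro rfl; have := nw _ h3.symm; tauto
    have d : ∀ y, (y ≠ z ∧ y ≠ z' ∧ y ≠ v ∧ y ≠ u) → y ≠ w →
        gdeg (swapE (T ⊔ edge w v) u w z z') y = gdeg T y := by
      intro y h1 h2
      apply gdeg_congr
      intro x; rw [hadj]; grind
    have dR : ∀ y, (y ≠ z ∧ y ≠ z' ∧ y ≠ v ∧ y ≠ u) → y ≠ w →
        gdeg (rest G {v}ᶜ) y = gdeg G y := by
      intro y h1 h2
      apply gdeg_congr
      intro x
      rw [rest_adj]
      refine ⟨fun h => h.1, fun h => ⟨h, h1.2.2.1, ?_⟩⟩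
      rintro rfl
      have := hv y h.symm
      tauto
    rw [d _ n1 m1] at h4
    rw [d _ n2 m2] at h5
    rw [d _ n3 m3] at h6
    rw [← dR _ n1 m1] at h7
    rw [← dR _ n2 m2] at h8
    rw [← dR _ n3 m3] at h9
    rw [hadj] at h2 h3
    exact hgood a b c ⟨h1, by grind, by grind, h4, h5, h6, h7, h8, h9⟩

/-- If `G` is a finite simple connected graph with no `G`-good spanning tree, while every
finite simple connected graph on fewer vertices has a good spanning tree (with respect to
itself), then `G` has minimum degree at least 3. -/
theorem stmt_7 (V : Type) [Fintype V] (G : SimpleGraph V) (hconn : G.Connected)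
    (hno : ¬∃ T : SimpleGraph V, T ≤ G ∧ T.IsTree ∧ GoodSubgraph G T)
    (hmin : ∀ (W : Type) [Fintype W] (G' : SimpleGraph W),
      Fintype.card W < Fintype.card V → G'.Connected →
      ∃ T : SimpleGraph W, T ≤ G' ∧ T.IsTree ∧ GoodSubgraph G' T) :
    ∀ v, 3 ≤ gdeg G v := by
  intro v
  by_contra hlt
  apply hno
  have hcard : gdeg G v = 0 ∨ gdeg G v = 1 ∨ gdeg G v = 2 := by omega
  have hnbr : (∀ x, ¬ G.Adj v x) ∨
      ∃ u w, G.Adj v u ∧ G.Adj v w ∧ ∀ x, G.Adj v x → x = u ∨ x = w := by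
    rcases hcard with h | h | h
    · left
      rw [gdeg_eq, Set.ncard_eq_zero (Set.toFinite _)] at h
      intro x hx
      exact Set.eq_empty_iff_forall_notMem.1 h x hx
    · right
      obtain ⟨a, ha⟩ := gdeg_one h
      exact ⟨a, a, (ha a).2 rfl, (ha a).2 rfl, fun x hx => Or.inl ((ha x).1 hx)⟩
    · right
      obtain ⟨a, b, -, ha⟩ := gdeg_two h
      exact ⟨a, b, (ha a).2 (Or.inl rfl), (ha b).2 (Or.inr rfl), fun x hx => (ha x).1 hx⟩
  rcases hnbr with h0 | ⟨u, w, hvu, hvw, hv⟩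
  · have hall : ∀ x, x = v := by
      intro x
      by_contra hx
      refine not_reach_of_closed (H := G) {v} ?_ rfl hx (hconn.preconnected v x)
      rintro a b hab rfl
      exact absurd hab (h0 b)
    have : Subsingleton V := ⟨fun a b => (hall a).trans (hall b).symm⟩
    refine ⟨G, le_rfl, ⟨hconn, IsAcyclic.of_subsingleton⟩, ?_⟩
    rintro ⟨a, b, c, hac, -⟩
    exact hac (Subsingleton.elim _ _)
  · by_cases huw : G.Adj u w
    · exact caseB hconn hmin hvu hvw hv huw
    · exact caseA hconn hmin hvu hvw hv huw
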